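/- arXiv:1507.01873 — 2 statements merged into one kernel-verified Lean document; each statement's English description precedes it below -/
import Mathlib

section
/- Let σ be a conductance matrix on n ≥ 2 nodes. If det Σ''(σ) = 0 then det Σ'(σ) = 0. (Physically: if the denominator of the equivalent-conductance formula vanishes, the numerator vanishes as well, so the equivalent conductance can be zero but never infinite.) -/
open Matrix BigOperators

/-- A conductance matrix: symmetric, nonnegative entries, zero diagonal. -/
def IsConductance {N : ℕ} (σ : Matrix (Fin N) (Fin N) ℝ) : Prop :=
  (∀ i j, σ i j = σ j i) ∧ (∀ i j, 0 ≤ σ i j) ∧ (∀ i, σ i i = 0)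

/-- The weighted Laplacian of a conductance matrix. -/
def lap {N : ℕ} (σ : Matrix (Fin N) (Fin N) ℝ) : Matrix (Fin N) (Fin N) ℝ :=
  Matrix.of fun i j => if i = j then ∑ k, σ i k else -σ i j

/-- Σ'(σ): the Laplacian with the row and column of the last node deleted. -/
def sigmaP {n : ℕ} (σ : Matrix (Fin (n+2)) (Fin (n+2)) ℝ) :
    Matrix (Fin (n+1)) (Fin (n+1)) ℝ :=
  (lap σ).submatrix Fin.castSucc Fin.castSucc

/-- Σ''(σ): the Laplacian with the rows and columns of the first and last nodes deleted. -/
def sigmaPP {n : ℕ} (σ : Matrix (Fin (n+2)) (Fin (n+2)) ℝ) :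
    Matrix (Fin n) (Fin n) ℝ :=
  (lap σ).submatrix (fun i => i.succ.castSucc) (fun i => i.succ.castSucc)

/-- The junction rules: total current out of each interior node vanishes. -/
def Junction {n : ℕ} (σ : Matrix (Fin (n+2)) (Fin (n+2)) ℝ) (V : Fin (n+2) → ℝ) : Prop :=
  ∀ i : Fin (n+2), i ≠ 0 → i ≠ Fin.last (n+1) → ∑ j, σ i j * (V i - V j) = 0

theorem lap_eq_diagonal_sub {N : ℕ} {σ : Matrix (Fin N) (Fin N) ℝ} (hσ : IsConductance σ) :
    lap σ = diagonal (fun i => ∑ k, σ i k) - σ := by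
  ext i j
  by_cases hij : i = j
  · subst hij
    simp [lap, hσ.2.2 i]
  · simp [lap, hij]

/-- The quadratic form of the Laplacian is the dissipated power. -/
theorem dotProduct_lap_mulVec {N : ℕ} {σ : Matrix (Fin N) (Fin N) ℝ} (hσ : IsConductance σ)
    (x : Fin N → ℝ) :
    x ⬝ᵥ (lap σ *ᵥ x) = (∑ i, ∑ j, σ i j * (x i - x j) ^ 2) / 2 := by
  have hform : x ⬝ᵥ (lap σ *ᵥ x) = ∑ i, ∑ j, σ i j * (x i * x i - x i * x j) := by
    rw [lap_eq_diagonal_sub hσ, sub_mulVec]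
    simp only [dotProduct, Pi.sub_apply, mulVec_diagonal]
    refine Finset.sum_congr rfl fun i _ => ?_
    rw [mulVec, dotProduct, Finset.sum_mul, ← Finset.sum_sub_distrib, Finset.mul_sum]
    exact Finset.sum_congr rfl fun j _ => by ring
  have hswap : x ⬝ᵥ (lap σ *ᵥ x) = ∑ i, ∑ j, σ i j * (x j * x j - x i * x j) := by
    rw [hform, Finset.sum_comm]
    refine Finset.sum_congr rfl fun i _ => Finset.sum_congr rfl fun j _ => ?_
    rw [hσ.1 j i]
    ring
  rw [eq_div_iff two_ne_zero, mul_two]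
  nth_rewrite 1 [hform]
  rw [hswap]
  simp only [← Finset.sum_add_distrib]
  exact Finset.sum_congr rfl fun i _ => Finset.sum_congr rfl fun j _ => by ring

theorem posSemidef_lap {N : ℕ} {σ : Matrix (Fin N) (Fin N) ℝ} (hσ : IsConductance σ) :
    (lap σ).PosSemidef := by
  refine .of_dotProduct_mulVec_nonneg (IsHermitian.ext fun i j => ?_) fun x => ?_
  · by_cases hij : i = j
    · simp [hij]
    · simp [lap, hij, Ne.symm hij, hσ.1 i j]
  · rw [star_trivial, dotProduct_lap_mulVec hσ]
    exact div_nonneg (Finset.sum_nonneg fun i _ => Finset.sum_nonneg fun j _ =>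
      mul_nonneg (hσ.2.1 i j) (sq_nonneg _)) zero_le_two

/-- If the denominator `det Σ''` of the equivalent-conductance formula vanishes, then so
does the numerator `det Σ'`. -/
theorem det_sigmaP_eq_zero_of_det_sigmaPP_eq_zero {n : ℕ}
    (σ : Matrix (Fin (n+2)) (Fin (n+2)) ℝ) (hσ : IsConductance σ)
    (h : (sigmaPP σ).det = 0) : (sigmaP σ).det = 0 := by
  by_contra hdet
  have hpos : (sigmaP σ).PosDef :=
    ((posSemidef_lap hσ).submatrix Fin.castSucc).posDef_iff_det_ne_zero.mpr hdet
  exact (hpos.submatrix (Fin.succ_injective n)).det_pos.ne' h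
end

section
/- Let σ, σ̃ be as in the series-reduction setup: σ is a conductance matrix on n ≥ 4 nodes, k is an interior node with σ k j = 0 for every j ∉ {l, m} (l, m distinct and different from k), σ k l + σ k m > 0, σ l m = 0, and σ̃ is obtained by deleting node k and setting σ̃ l m = (σ k l · σ k m)/(σ k l + σ k m). If det Σ''(σ̃) ≠ 0, then det Σ''(σ) ≠ 0 and the equivalent conductances agree: det Σ'(σ)/det Σ''(σ) = det Σ'(σ̃)/det Σ''(σ̃). -/
open Matrix BigOperators

/-- The Schur complement formula for the determinant, pivoting on the diagonal entry at `k`. -/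
theorem det_eq_mul_det_schur {p : ℕ} (M : Matrix (Fin (p+1)) (Fin (p+1)) ℝ) (k : Fin (p+1))
    (hk : M k k ≠ 0) :
    M.det = M k k * (Matrix.of fun i j : Fin p => M (k.succAbove i) (k.succAbove j) -
      M (k.succAbove i) k * M k (k.succAbove j) / M k k).det := by
  let e : Fin p ⊕ Unit ≃ Fin (p+1) :=
    ((finSuccEquiv' k).trans (Equiv.optionEquivSumPUnit (Fin p))).symm
  have hel (i : Fin p) : e (Sum.inl i) = k.succAbove i := by simp [e]
  have her (u : Unit) : e (Sum.inr u) = k := by simp [e]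
  let D : Matrix Unit Unit ℝ := Matrix.of fun _ _ => M k k
  let Dinv : Matrix Unit Unit ℝ := Matrix.of fun _ _ => (M k k)⁻¹
  let _ : Invertible D := ⟨Dinv, by ext; simp [D, Dinv, Matrix.mul_apply, hk],
    by ext; simp [D, Dinv, Matrix.mul_apply, hk]⟩
  have hblocks : M.submatrix e e = Matrix.fromBlocks
      (Matrix.of fun i j : Fin p => M (k.succAbove i) (k.succAbove j))
      (Matrix.of fun i _ => M (k.succAbove i) k)
      (Matrix.of fun _ j => M k (k.succAbove j)) D := by
    ext (i | i) (j | j) <;> simp [hel, her, D]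
  rw [← Matrix.det_submatrix_equiv_self e M, hblocks, Matrix.det_fromBlocks₂₂]
  congr 1
  · simp [D]
  · congr 1
    ext i j
    change _ - (_ * Dinv * _ : Matrix (Fin p) (Fin p) ℝ) i j = _
    simp [Dinv, Matrix.mul_apply]
    ring

/-- The Laplacian of the series reduction at `k` is the Schur complement of the Laplacian
at `k`. -/
theorem lap_series_reduction {N : ℕ} (σ : Matrix (Fin (N+1)) (Fin (N+1)) ℝ)
    (hσ : IsConductance σ) (k : Fin (N+1)) (l m : Fin N) (hlm : l ≠ m)
    (hdeg : ∀ j, j ≠ l → j ≠ m → σ k (k.succAbove j) = 0)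
    (hs : σ k (k.succAbove l) + σ k (k.succAbove m) ≠ 0)
    (hser : σ (k.succAbove l) (k.succAbove m) = 0) (σt : Matrix (Fin N) (Fin N) ℝ)
    (hσt : ∀ i j, σt i j = if (i = l ∧ j = m) ∨ (i = m ∧ j = l)
      then σ k (k.succAbove l) * σ k (k.succAbove m) /
        (σ k (k.succAbove l) + σ k (k.succAbove m))
      else σ (k.succAbove i) (k.succAbove j)) (i j : Fin N) :
    lap σt i j = lap σ (k.succAbove i) (k.succAbove j) -
      lap σ (k.succAbove i) k * lap σ k (k.succAbove j) /
        (σ k (k.succAbove l) + σ k (k.succAbove m)) := by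
  obtain ⟨hsymm, -, -⟩ := hσ
  have hser' : σ (k.succAbove m) (k.succAbove l) = 0 := by rw [hsymm, hser]
  have hentry (i j : Fin N) : σt i j = σ (k.succAbove i) (k.succAbove j) +
      ((if j = m then if i = l then σ k (k.succAbove l) * σ k (k.succAbove m) /
        (σ k (k.succAbove l) + σ k (k.succAbove m)) else 0 else 0) +
      (if j = l then if i = m then σ k (k.succAbove l) * σ k (k.succAbove m) /
        (σ k (k.succAbove l) + σ k (k.succAbove m)) else 0 else 0)) := by
    rw [hσt]
    split_ifs <;> grind
  have hrow (i : Fin N) : ∑ j, σt i j = ∑ j, σ (k.succAbove i) (k.succAbove j) +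
      ((if i = l then σ k (k.succAbove l) * σ k (k.succAbove m) /
        (σ k (k.succAbove l) + σ k (k.succAbove m)) else 0) +
      (if i = m then σ k (k.succAbove l) * σ k (k.succAbove m) /
        (σ k (k.succAbove l) + σ k (k.succAbove m)) else 0)) := by
    simp only [hentry, Finset.sum_add_distrib, Finset.sum_ite_eq',
      Finset.mem_univ, if_true]
  simp only [lap, Matrix.of_apply, Fin.succAbove_right_inj, Fin.succAbove_ne,
    (Fin.succAbove_ne k _).symm, if_false, hrow, Fin.sum_univ_succAbove _ k, hsymm _ k]
  by_cases hij : i = j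
  · subst hij
    simp only [if_true]
    by_cases hil : i = l
    · subst hil
      simp only [hlm, if_true, if_false]
      field_simp
      ring
    · by_cases him : i = m
      · subst him
        simp only [hil, if_true, if_false]
        field_simp
        ring
      · simp [hil, him, hdeg i hil him]
  · simp only [hij, if_false, hσt]
    by_cases h : (i = l ∧ j = m) ∨ (i = m ∧ j = l)
    · rw [if_pos h]
      obtain ⟨rfl, rfl⟩ | ⟨rfl, rfl⟩ := h
      · rw [hser]
        ring
      · rw [hser']
        ring
    · rw [if_neg h]
      have hz : σ k (k.succAbove i) = 0 ∨ σ k (k.succAbove j) = 0 := by grind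
      obtain hz | hz := hz <;> simp [hz]

/-- Series reduction preserves the equivalent conductance: in the series-reduction setup,
if `det Σ''` of the reduced circuit is nonzero then so is that of the original circuit,
and the two equivalent conductances agree. -/
theorem series_reduction_equiv_conductance {n : ℕ} (σ : Matrix (Fin (n+4)) (Fin (n+4)) ℝ)
    (hσ : IsConductance σ) (k l m : Fin (n+4))
    (hk0 : k ≠ 0) (hkn : k ≠ Fin.last (n+3))
    (hlm : l ≠ m) (hlk : l ≠ k) (hmk : m ≠ k)
    (hdeg : ∀ j, j ≠ l → j ≠ m → σ k j = 0)
    (hpos : 0 < σ k l + σ k m) (hser : σ l m = 0) :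
    let σt : Matrix (Fin (n+3)) (Fin (n+3)) ℝ := Matrix.of fun i j =>
      if (k.succAbove i = l ∧ k.succAbove j = m) ∨ (k.succAbove i = m ∧ k.succAbove j = l)
      then σ k l * σ k m / (σ k l + σ k m)
      else σ (k.succAbove i) (k.succAbove j)
    (sigmaPP σt).det ≠ 0 →
      (sigmaPP σ).det ≠ 0 ∧
      (sigmaP σ).det / (sigmaPP σ).det = (sigmaP σt).det / (sigmaPP σt).det := by
  intro σt hdet
  obtain ⟨l, rfl⟩ := Fin.exists_succAbove_eq hlk
  obtain ⟨m, rfl⟩ := Fin.exists_succAbove_eq hmk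
  have hlap := lap_series_reduction σ hσ k l m (fun h => hlm (by rw [h]))
    (fun j hjl hjm => hdeg _ (by simpa using hjl) (by simpa using hjm)) hpos.ne' hser σt
    (fun i j => by simp only [σt, Matrix.of_apply, Fin.succAbove_right_inj])
  have hkk : lap σ k k = σ k (k.succAbove l) + σ k (k.succAbove m) := by
    simp only [lap, Matrix.of_apply, if_true]
    exact Fintype.sum_eq_add _ _ hlm fun j hj => hdeg j hj.1 hj.2
  have hne : lap σ k k ≠ 0 := hkk ▸ hpos.ne'
  rw [← hkk] at hlap
  obtain ⟨k, rfl⟩ := Fin.exists_castSucc_eq.2 hkn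
  obtain ⟨q, rfl⟩ := Fin.exists_succ_eq.2 (show k ≠ 0 by rintro rfl; exact hk0 rfl)
  have hP : (sigmaP σ).det = lap σ q.succ.castSucc q.succ.castSucc * (sigmaP σt).det := by
    rw [det_eq_mul_det_schur (sigmaP σ) q.succ hne]
    congr 2
    ext i j
    simp only [sigmaP, Matrix.submatrix_apply, Matrix.of_apply, hlap,
      Fin.castSucc_succAbove_castSucc]
  have hPP : (sigmaPP σ).det = lap σ q.succ.castSucc q.succ.castSucc * (sigmaPP σt).det := by
    rw [det_eq_mul_det_schur (sigmaPP σ) q hne]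
    congr 2
    ext i j
    simp only [sigmaPP, Matrix.submatrix_apply, Matrix.of_apply, hlap,
      Fin.castSucc_succAbove_castSucc, Fin.succ_succAbove_succ]
  rw [hP, hPP]
  exact ⟨mul_ne_zero hne hdet, mul_div_mul_left _ _ hne⟩
end
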